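/- Let p ≥ 1, let S be a p×p real symmetric positive semidefinite matrix and let ρ > 0, and set α = 1/(‖S‖₂ + pρ). If Θ* is a p×p real symmetric positive definite matrix that minimizes F(Θ) = −log det Θ + Tr(SΘ) + ρ·Σ_{i,j}|Θ_{ij}| over all p×p real symmetric positive definite matrices, then Θ* ⪯ ((p − α·Tr(S))/ρ)·I. -/

import Mathlib

open Matrix

/-- Entrywise soft-thresholding operator `η_c`. -/
noncomputable def softThresh {n : Type*} [Fintype n] (c : ℝ) (X : Matrix n n ℝ) :
    Matrix n n ℝ :=
  fun i j => Real.sign (X i j) * max (|X i j| - c) 0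

/-- Frobenius norm of a real matrix. -/
noncomputable def frobNorm {n : Type*} [Fintype n] (A : Matrix n n ℝ) : ℝ :=
  Real.sqrt (∑ i, ∑ j, (A i j) ^ 2)

/-- Smallest eigenvalue of a real symmetric matrix (as the infimum of the
Rayleigh quotient over the unit sphere). -/
noncomputable def lmin {n : Type*} [Fintype n] (A : Matrix n n ℝ) : ℝ :=
  ⨅ x : {x : n → ℝ // ∑ i, (x i) ^ 2 = 1}, x.1 ⬝ᵥ A.mulVec x.1

/-- Largest eigenvalue of a real symmetric matrix. -/
noncomputable def lmax {n : Type*} [Fintype n] (A : Matrix n n ℝ) : ℝ :=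
  ⨆ x : {x : n → ℝ // ∑ i, (x i) ^ 2 = 1}, x.1 ⬝ᵥ A.mulVec x.1

/-- Spectral norm (largest singular value) of a real matrix. -/
noncomputable def specNorm {n : Type*} [Fintype n] (A : Matrix n n ℝ) : ℝ :=
  ⨆ x : {x : n → ℝ // ∑ i, (x i) ^ 2 = 1}, Real.sqrt (∑ i, (A.mulVec x.1 i) ^ 2)

open Finset in
theorem dotProduct_mulVec_le_sum_abs {n : Type*} [Fintype n] (A : Matrix n n ℝ) (x : n → ℝ) :
    x ⬝ᵥ A *ᵥ x ≤ (∑ i, ∑ j, |A i j|) * (x ⬝ᵥ x) := by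
  have hsq (i : n) : x i ^ 2 ≤ x ⬝ᵥ x := by
    simp only [dotProduct, ← sq]
    exact single_le_sum (f := fun i => x i ^ 2) (fun j _ => sq_nonneg (x j)) (mem_univ i)
  simp only [sum_mul]
  refine sum_le_sum fun i _ => ?_
  rw [mulVec, dotProduct, mul_sum]
  refine sum_le_sum fun j _ => ?_
  have hxx : |x i * x j| ≤ x ⬝ᵥ x := by
    rw [abs_le]
    constructor <;> nlinarith [hsq i, hsq j, sq_nonneg (x i + x j), sq_nonneg (x i - x j)]
  calc x i * (A i j * x j) = A i j * (x i * x j) := by ring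
    _ ≤ |A i j| * |x i * x j| := (le_abs_self _).trans (abs_mul _ _).le
    _ ≤ |A i j| * (x ⬝ᵥ x) := by gcongr

theorem sum_abs_vecMulVec_le {n : Type*} [Fintype n] (v : n → ℝ) :
    ∑ i, ∑ j, |vecMulVec v v i j| ≤ Fintype.card n * (v ⬝ᵥ v) := by
  have h := sq_sum_le_card_mul_sum_sq (s := Finset.univ) (f := fun i => |v i|)
  simp only [sq_abs, Finset.card_univ] at h
  simpa [vecMulVec_apply, abs_mul, ← Finset.mul_sum, ← Finset.sum_mul, dotProduct, ← sq] using h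

theorem bddAbove_range_norm_mulVec {n : Type*} [Fintype n] (A : Matrix n n ℝ) :
    BddAbove (Set.range fun x : {x : n → ℝ // ∑ i, (x i) ^ 2 = 1} =>
      Real.sqrt (∑ i, (A.mulVec x.1 i) ^ 2)) := by
  refine ⟨Real.sqrt (∑ i, ∑ j, A i j ^ 2), ?_⟩
  rintro _ ⟨⟨x, hx⟩, rfl⟩
  refine Real.sqrt_le_sqrt (Finset.sum_le_sum fun i _ => ?_)
  simpa [hx, mulVec, dotProduct] using Finset.sum_mul_sq_le_sq_mul_sq Finset.univ (A i) x

theorem dotProduct_mulVec_le_specNorm {n : Type*} [Fintype n] (A : Matrix n n ℝ) (v : n → ℝ) :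
    v ⬝ᵥ A *ᵥ v ≤ specNorm A * (v ⬝ᵥ v) := by
  have unit (x : n → ℝ) (hx : ∑ i, (x i) ^ 2 = 1) : x ⬝ᵥ A *ᵥ x ≤ specNorm A := by
    refine le_trans ?_ (le_ciSup (bddAbove_range_norm_mulVec A) ⟨x, hx⟩)
    refine Real.le_sqrt_of_sq_le ?_
    simpa [hx, dotProduct] using
      Finset.sum_mul_sq_le_sq_mul_sq Finset.univ x (A *ᵥ x)
  rcases eq_or_ne v 0 with rfl | hv
  · simp
  have hpos : 0 < v ⬝ᵥ v := by simpa using dotProduct_star_self_pos_iff.mpr hv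
  set r := Real.sqrt (v ⬝ᵥ v) with hr
  have hrpos : 0 < r := Real.sqrt_pos.mpr hpos
  have hrr : r ^ 2 = v ⬝ᵥ v := Real.sq_sqrt hpos.le
  have h := unit (r⁻¹ • v) (by
    have : ∑ i, (v i) ^ 2 = r ^ 2 := by simp [hrr, dotProduct, sq]
    simp only [Pi.smul_apply, smul_eq_mul, mul_pow, ← Finset.mul_sum, this]
    field_simp)
  rw [mulVec_smul, dotProduct_smul, smul_dotProduct, smul_eq_mul, smul_eq_mul] at h
  rw [← hrr]
  calc v ⬝ᵥ A *ᵥ v = (r⁻¹ * (r⁻¹ * (v ⬝ᵥ A *ᵥ v))) * r ^ 2 := by field_simp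
    _ ≤ _ := by gcongr

theorem specNorm_nonneg {n : Type*} [Fintype n] (A : Matrix n n ℝ) : 0 ≤ specNorm A :=
  Real.iSup_nonneg fun _ => Real.sqrt_nonneg _

theorem trace_vecMulVec_mul {n : Type*} [Fintype n] (v w : n → ℝ) (M : Matrix n n ℝ) :
    (vecMulVec v w * M).trace = w ⬝ᵥ M *ᵥ v := by
  rw [vecMulVec_mul, trace_vecMulVec, dotProduct_comm, ← dotProduct_mulVec]

theorem Matrix.PosSemidef.trace_mul_nonneg {n : Type*} [Fintype n] {A B : Matrix n n ℝ}
    (hA : A.PosSemidef) (hB : B.PosSemidef) : 0 ≤ (A * B).trace := by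
  obtain ⟨m, v, rfl⟩ := posSemidef_iff_eq_sum_vecMulVec.mp hA
  rw [Finset.sum_mul, trace_sum]
  refine Finset.sum_nonneg fun i _ => ?_
  rw [trace_vecMulVec_mul]
  exact hB.dotProduct_mulVec_nonneg (v i)

theorem det_add_smul_vecMulVec {n : Type*} [Fintype n] [DecidableEq n] {A : Matrix n n ℝ}
    (hA : IsUnit A.det) (t : ℝ) (v : n → ℝ) :
    (A + t • vecMulVec v v).det = A.det * (1 + t * (v ⬝ᵥ A⁻¹ *ᵥ v)) := by
  rw [← smul_vecMulVec, vecMulVec_eq Unit, det_add_replicateCol_mul_replicateRow hA,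
    det_unique (n := Unit),
    Matrix.mul_assoc, ← replicateCol_mulVec, Matrix.add_apply, replicateRow_mul_replicateCol_apply,
    mulVec_smul, dotProduct_smul, one_apply_eq, smul_eq_mul]

/-- The `ℓ1`-penalized negative Gaussian log-likelihood. -/
noncomputable def penalizedNegLogLik {n : Type*} [Fintype n] [DecidableEq n]
    (S : Matrix n n ℝ) (ρ : ℝ) (Θ : Matrix n n ℝ) : ℝ :=
  -Real.log Θ.det + (S * Θ).trace + ρ * ∑ i, ∑ j, |Θ i j|

section Minimizer

variable {n : Type*} [Fintype n] [DecidableEq n] {S Θs : Matrix n n ℝ} {ρ : ℝ}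

/-- Stationarity of a minimizer under the scaling `Θ ↦ t • Θ`. -/
theorem trace_add_penalty_le_card (hΘs : Θs.PosDef)
    (hmin : ∀ Θ : Matrix n n ℝ, Θ.PosDef →
      penalizedNegLogLik S ρ Θs ≤ penalizedNegLogLik S ρ Θ) :
    (S * Θs).trace + ρ * ∑ i, ∑ j, |Θs i j| ≤ Fintype.card n := by
  set c := (S * Θs).trace + ρ * ∑ i, ∑ j, |Θs i j| with hc
  have key (t : ℝ) (ht : 0 < t) : c ≤ t * c - Fintype.card n * Real.log t := by
    have h := hmin (t • Θs) (hΘs.smul ht)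
    have hsum : ∑ i, ∑ j, |(t • Θs) i j| = t * ∑ i, ∑ j, |Θs i j| := by
      simp [abs_mul, abs_of_pos ht, Finset.mul_sum]
    rw [penalizedNegLogLik, penalizedNegLogLik, hsum, det_smul,
      Real.log_mul (by positivity) hΘs.det_pos.ne', Real.log_pow, Matrix.mul_smul, trace_smul,
      smul_eq_mul] at h
    linarith
  by_contra! hlt
  have hp : (0 : ℝ) ≤ Fintype.card n := Nat.cast_nonneg _
  have hc0 : 0 < c := hp.trans_lt hlt
  set t := (Fintype.card n / c + 1) / 2 with ht
  have htc : t * c = (Fintype.card n + c) / 2 := by rw [ht]; field_simp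
  have ht0 : 0 < t := by positivity
  have ht1 : t < 1 := by nlinarith
  have h1 := key t ht0
  have h2 := mul_le_mul_of_nonneg_left (Real.one_sub_inv_le_log_of_pos ht0) hp
  have h3 : c * (1 - t) ≤ Fintype.card n * (t⁻¹ - 1) := by linarith
  have h4 : t⁻¹ - 1 = (1 - t) / t := by field_simp
  rw [h4, ← mul_div_assoc, le_div_iff₀ ht0] at h3
  nlinarith

/-- Stationarity of a minimizer under rank-one perturbations `Θ + t • v vᵀ`. -/
theorem dotProduct_inv_mulVec_le (hρ : 0 < ρ) (hΘs : Θs.PosDef)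
    (hmin : ∀ Θ : Matrix n n ℝ, Θ.PosDef →
      penalizedNegLogLik S ρ Θs ≤ penalizedNegLogLik S ρ Θ) (v : n → ℝ) :
    v ⬝ᵥ Θs⁻¹ *ᵥ v ≤ (specNorm S + Fintype.card n * ρ) * (v ⬝ᵥ v) := by
  set q := v ⬝ᵥ Θs⁻¹ *ᵥ v with hq
  set K := (specNorm S + Fintype.card n * ρ) * (v ⬝ᵥ v) with hK
  have hq0 : 0 ≤ q := by simpa using hΘs.inv.posSemidef.dotProduct_mulVec_nonneg v
  have hv0 : 0 ≤ v ⬝ᵥ v := by simpa using dotProduct_star_self_nonneg v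
  have hK0 : 0 ≤ K := mul_nonneg (add_nonneg (specNorm_nonneg S) (by positivity)) hv0
  have hlog (t : ℝ) (ht : 0 < t) : Real.log (1 + t * q) ≤ t * K := by
    have hvv : (vecMulVec v v).PosSemidef := by simpa using posSemidef_vecMulVec_self_star v
    have h := hmin (Θs + t • vecMulVec v v) (hΘs.add_posSemidef (hvv.smul ht.le))
    have hsum : ∑ i, ∑ j, |(Θs + t • vecMulVec v v) i j| ≤
        ∑ i, ∑ j, |Θs i j| + t * ∑ i, ∑ j, |vecMulVec v v i j| := by
      simp only [Finset.mul_sum, ← Finset.sum_add_distrib]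
      gcongr with i _ j _
      refine (abs_add_le _ _).trans_eq ?_
      simp [abs_mul, abs_of_pos ht]
    have htr : (S * vecMulVec v v).trace ≤ specNorm S * (v ⬝ᵥ v) := by
      rw [trace_mul_comm, trace_vecMulVec_mul]
      exact dotProduct_mulVec_le_specNorm S v
    rw [penalizedNegLogLik, penalizedNegLogLik,
      det_add_smul_vecMulVec (isUnit_iff_ne_zero.mpr hΘs.det_pos.ne'),
      Real.log_mul hΘs.det_pos.ne' (by positivity), Matrix.mul_add, trace_add, Matrix.mul_smul,
      trace_smul, smul_eq_mul] at h
    have h1 := mul_le_mul_of_nonneg_left htr ht.le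
    have h2 := mul_le_mul_of_nonneg_left
      (hsum.trans (add_le_add_right (mul_le_mul_of_nonneg_left (sum_abs_vecMulVec_le v) ht.le) _))
      hρ.le
    rw [hK]
    linarith
  have hlin (t : ℝ) (ht : 0 < t) : q ≤ K * (1 + t * q) := by
    have hpos : 0 < 1 + t * q := by positivity
    have h := (Real.one_sub_inv_le_log_of_pos hpos).trans (hlog t ht)
    have h4 : 1 - (1 + t * q)⁻¹ = t * q / (1 + t * q) := by field_simp; ring
    rw [h4, div_le_iff₀ hpos, mul_assoc] at h
    exact le_of_mul_le_mul_left h ht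
  refine le_of_forall_pos_le_add fun ε hε => ?_
  have h := hlin (ε / (K * q + 1)) (by positivity)
  have h5 : K * (ε / (K * q + 1) * q) ≤ ε := by
    have : K * (ε / (K * q + 1) * q) = ε * (K * q) / (K * q + 1) := by ring
    rw [this, div_le_iff₀ (by positivity)]
    nlinarith
  linarith

end Minimizer

/-- An upper bound on the inverse of a positive definite matrix is a lower bound on the matrix. -/
theorem Matrix.PosDef.sub_smul_one_posSemidef {n : Type*} [Fintype n] [DecidableEq n]
    {A : Matrix n n ℝ} (hA : A.PosDef) {α : ℝ} (hα : 0 ≤ α)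
    (h : ∀ v, α * (v ⬝ᵥ A⁻¹ *ᵥ v) ≤ v ⬝ᵥ v) : (A - α • 1).PosSemidef := by
  refine .of_dotProduct_mulVec_nonneg
    (hA.isHermitian.sub (isHermitian_one.smul (IsSelfAdjoint.all α))) fun x => ?_
  have hu : IsUnit A.det := isUnit_iff_ne_zero.mpr hA.det_pos.ne'
  have hAinv : A *ᵥ A⁻¹ *ᵥ x = x := by rw [mulVec_mulVec, mul_nonsing_inv A hu, one_mulVec]
  have hsymm : (A⁻¹ *ᵥ x) ⬝ᵥ A *ᵥ x = x ⬝ᵥ x := by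
    have hT : Aᵀ = A := by simpa [conjTranspose] using hA.isHermitian.eq
    rw [dotProduct_mulVec, ← mulVec_transpose, hT, hAinv]
  have hw := hA.posSemidef.dotProduct_mulVec_nonneg (x - α • (A⁻¹ *ᵥ x))
  simp only [star_trivial, mulVec_sub, mulVec_smul, hAinv, sub_dotProduct, dotProduct_sub,
    smul_dotProduct, dotProduct_smul, hsymm, smul_eq_mul, dotProduct_comm (A⁻¹ *ᵥ x) x] at hw
  simp only [star_trivial, sub_mulVec, smul_mulVec, one_mulVec, dotProduct_sub, dotProduct_smul,
    smul_eq_mul]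
  have h1 := mul_le_mul_of_nonneg_left (h x) hα
  linarith

/-- Upper eigenvalue bound for the minimizer of the ℓ1-penalized negative
Gaussian log-likelihood: `Θ* ⪯ ((p − α Tr S)/ρ) I` with `α = 1/(‖S‖₂ + pρ)`. -/
theorem optimal_point_upper_bound {p : ℕ} (hp : 0 < p)
    (S : Matrix (Fin p) (Fin p) ℝ) (hS : S.PosSemidef)
    (ρ : ℝ) (hρ : 0 < ρ)
    (α : ℝ) (hα : α = 1 / (specNorm S + p * ρ))
    (F : Matrix (Fin p) (Fin p) ℝ → ℝ)
    (hF : ∀ Θ, F Θ = -Real.log Θ.det + (S * Θ).trace + ρ * ∑ i, ∑ j, |Θ i j|)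
    (Θs : Matrix (Fin p) (Fin p) ℝ) (hΘs : Θs.PosDef)
    (hmin : ∀ Θ : Matrix (Fin p) (Fin p) ℝ, Θ.PosDef → F Θs ≤ F Θ) :
    ((((p : ℝ) - α * S.trace) / ρ) • 1 - Θs).PosSemidef := by
  have hF' : F = penalizedNegLogLik S ρ := funext hF
  subst hF'
  have hcard : (p : ℝ) = Fintype.card (Fin p) := by simp
  have hK : 0 < specNorm S + p * ρ :=
    add_pos_of_nonneg_of_pos (specNorm_nonneg S) (by positivity)
  have hα0 : 0 ≤ α := hα ▸ by positivity
  have hlower : (Θs - α • 1).PosSemidef := by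
    refine hΘs.sub_smul_one_posSemidef hα0 fun v => ?_
    have h := dotProduct_inv_mulVec_le hρ hΘs hmin v
    rw [← hcard] at h
    rw [hα, one_div, inv_mul_le_iff₀ hK]
    exact h
  have htrace := hS.trace_mul_nonneg hlower
  rw [Matrix.mul_sub, trace_sub, Matrix.mul_smul, Matrix.mul_one, trace_smul, smul_eq_mul]
    at htrace
  have hscale := trace_add_penalty_le_card hΘs hmin
  rw [← hcard] at hscale
  have hl1 : ∑ i, ∑ j, |Θs i j| ≤ ((p : ℝ) - α * S.trace) / ρ := by
    rw [le_div_iff₀ hρ]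
    linarith
  refine .of_dotProduct_mulVec_nonneg
    ((isHermitian_one.smul (IsSelfAdjoint.all _)).sub hΘs.isHermitian) fun x => ?_
  have hx : 0 ≤ x ⬝ᵥ x := by simpa using dotProduct_star_self_nonneg x
  simp only [star_trivial, sub_mulVec, smul_mulVec, one_mulVec, dotProduct_sub, dotProduct_smul,
    smul_eq_mul]
  have h1 := dotProduct_mulVec_le_sum_abs Θs x
  have h2 := mul_le_mul_of_nonneg_right hl1 hx
  linarith
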